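/- Correctness of the strengthening relation for LTL: for all LTL formulas φ and ψ with φ ↣ ψ (ψ is obtained from φ by the syntactic strengthening relation), ψ is stronger than φ; that is, for every infinite sequence π : ℕ → Set AP of subsets of atomic propositions and every k ∈ ℕ, if (π, k) ⊨ ψ then (π, k) ⊨ φ. -/

import Mathlib

/-- Syntax of LTL over a type `AP` of atomic propositions: ⊤, atoms,
negation, disjunction, bounded until `U_{[i,j)}` (with `i : ℕ`,
`j : ℕ∞ = ℕ ∪ {∞}`), and next. -/
inductive LTL (AP : Type) : Type where
  | tt : LTL AP
  | atom : AP → LTL AP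
  | not : LTL AP → LTL AP
  | or : LTL AP → LTL AP → LTL AP
  | untl : ℕ → ℕ∞ → LTL AP → LTL AP → LTL AP
  | next : LTL AP → LTL AP

namespace LTL

variable {AP : Type}

/-- Conjunction: φ ∧ ψ := ¬((¬φ) ∨ (¬ψ)). -/
def and (φ ψ : LTL AP) : LTL AP := .not (.or (.not φ) (.not ψ))

/-- Bounded eventually: ◇_{[i,j)}φ := ⊤ U_{[i,j)} φ. -/
def evI (i : ℕ) (j : ℕ∞) (φ : LTL AP) : LTL AP := .untl i j .tt φ

/-- Bounded globally: □_{[i,j)}φ := ¬◇_{[i,j)}¬φ. -/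
def glI (i : ℕ) (j : ℕ∞) (φ : LTL AP) : LTL AP := .not (evI i j (.not φ))

/-- Unbounded until: φ U ψ := φ U_{[0,∞)} ψ. -/
def untlInf (φ ψ : LTL AP) : LTL AP := .untl 0 ⊤ φ ψ

/-- Eventually: ◇φ := ◇_{[0,∞)}φ. -/
def ev (φ : LTL AP) : LTL AP := evI 0 ⊤ φ

/-- Globally: □φ := □_{[0,∞)}φ. -/
def gl (φ : LTL AP) : LTL AP := glI 0 ⊤ φ

/-- The satisfaction relation `(π, k) ⊨ φ`. -/
def Sat (π : ℕ → Set AP) : ℕ → LTL AP → Prop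
  | _, .tt => True
  | k, .atom p => p ∈ π k
  | k, .not φ => ¬ Sat π k φ
  | k, .or φ ψ => Sat π k φ ∨ Sat π k ψ
  | k, .untl i j φ ψ =>
      ∃ l : ℕ, k + i ≤ l ∧ (l : ℕ∞) < (k : ℕ∞) + j ∧ Sat π l ψ ∧
        ∀ m, k ≤ m → m ≤ l → Sat π m φ
  | k, .next φ => Sat π (k + 1) φ

/-- The strengthening relation `φ ↣ ψ` on LTL formulas, defined as the
smallest relation closed under the thirteen rules of the paper. -/
inductive Strengthen : LTL AP → LTL AP → Prop where
  /-- (1) (μ ∨ ν) ↣ (μ ∧ ν) -/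
  | or_and (μ ν : LTL AP) : Strengthen (.or μ ν) (and μ ν)
  /-- (2) ◇μ ↣ □◇μ -/
  | ev_glEv (μ : LTL AP) : Strengthen (ev μ) (gl (ev μ))
  /-- (3) □◇μ ↣ ◇□μ -/
  | glEv_evGl (μ : LTL AP) : Strengthen (gl (ev μ)) (ev (gl μ))
  /-- (4) ◇□μ ↣ □μ -/
  | evGl_gl (μ : LTL AP) : Strengthen (ev (gl μ)) (gl μ)
  /-- (5) ◇_{[i,j)}μ ↣ □_{[i,j)}μ for i < j -/
  | evI_glI (μ : LTL AP) (i : ℕ) (j : ℕ∞) (hij : (i : ℕ∞) < j) :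
      Strengthen (evI i j μ) (glI i j μ)
  /-- (6) (μ U ν) ↣ (□μ ∧ □◇ν) -/
  | untl_glAndGlEv (μ ν : LTL AP) :
      Strengthen (untlInf μ ν) (and (gl μ) (gl (ev ν)))
  /-- (7) ◇_{[i,j)}μ ↣ ◇_{[i',j')}μ whenever [i,j) ⊋ [i',j') -/
  | evI_shrink (μ : LTL AP) (i i' : ℕ) (j j' : ℕ∞)
      (hi : i ≤ i') (hj : j' ≤ j) (hne : (i, j) ≠ (i', j')) :
      Strengthen (evI i j μ) (evI i' j' μ)
  /-- (8) if ν ↣ μ then ¬μ ↣ ¬ν -/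
  | not_anti (μ ν : LTL AP) (h : Strengthen ν μ) : Strengthen (.not μ) (.not ν)
  /-- (9) if μ ↣ μ' then (μ ∨ ν) ↣ (μ' ∨ ν) -/
  | or_left (μ μ' ν : LTL AP) (h : Strengthen μ μ') :
      Strengthen (.or μ ν) (.or μ' ν)
  /-- (10) if ν ↣ ν' then (μ ∨ ν) ↣ (μ ∨ ν') -/
  | or_right (μ ν ν' : LTL AP) (h : Strengthen ν ν') :
      Strengthen (.or μ ν) (.or μ ν')
  /-- (11) if μ ↣ ν then Xμ ↣ Xν -/
  | next (μ ν : LTL AP) (h : Strengthen μ ν) : Strengthen (.next μ) (.next ν)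
  /-- (12) if ν ↣ ν' and i < j then (μ U_{[i,j)} ν) ↣ (μ U_{[i,j)} ν') -/
  | untl_right (μ ν ν' : LTL AP) (i : ℕ) (j : ℕ∞) (hij : (i : ℕ∞) < j)
      (h : Strengthen ν ν') : Strengthen (.untl i j μ ν) (.untl i j μ ν')
  /-- (13) transitivity -/
  | trans (φ μ ψ : LTL AP) (h₁ : Strengthen φ μ) (h₂ : Strengthen μ ψ) :
      Strengthen φ ψ

end LTL

namespace LTL

theorem sat_and {AP : Type} (π : ℕ → Set AP) (k : ℕ) (φ ψ : LTL AP) :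
    Sat π k (and φ ψ) ↔ Sat π k φ ∧ Sat π k ψ := by
  simp only [and, Sat, not_or, not_not]

theorem sat_evI {AP : Type} (π : ℕ → Set AP) (k i : ℕ) (j : ℕ∞) (φ : LTL AP) :
    Sat π k (evI i j φ) ↔ ∃ l : ℕ, k + i ≤ l ∧ (l : ℕ∞) < (k : ℕ∞) + j ∧ Sat π l φ := by
  simp [evI, Sat]

theorem sat_glI {AP : Type} (π : ℕ → Set AP) (k i : ℕ) (j : ℕ∞) (φ : LTL AP) :
    Sat π k (glI i j φ) ↔ ∀ l : ℕ, k + i ≤ l → (l : ℕ∞) < (k : ℕ∞) + j → Sat π l φ := by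
  simp [glI, Sat, sat_evI]

theorem sat_ev {AP : Type} (π : ℕ → Set AP) (k : ℕ) (φ : LTL AP) :
    Sat π k (ev φ) ↔ ∃ l, k ≤ l ∧ Sat π l φ := by
  simp [ev, sat_evI]

theorem sat_gl {AP : Type} (π : ℕ → Set AP) (k : ℕ) (φ : LTL AP) :
    Sat π k (gl φ) ↔ ∀ l, k ≤ l → Sat π l φ := by
  simp [gl, sat_glI]

theorem sat_untlInf {AP : Type} (π : ℕ → Set AP) (k : ℕ) (φ ψ : LTL AP) :
    Sat π k (untlInf φ ψ) ↔
      ∃ l, k ≤ l ∧ Sat π l ψ ∧ ∀ m, k ≤ m → m ≤ l → Sat π m φ := by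
  simp [untlInf, Sat]

end LTL

/-- Correctness of the strengthening relation: if φ ↣ ψ then ψ is stronger
than φ, i.e. for every π : ℕ → Set AP and k ∈ ℕ, (π,k) ⊨ ψ implies (π,k) ⊨ φ. -/
theorem strengthen_correct {AP : Type} (φ ψ : LTL AP)
    (h : LTL.Strengthen φ ψ) (π : ℕ → Set AP) (k : ℕ) :
    LTL.Sat π k ψ → LTL.Sat π k φ := by
  induction h generalizing k with
  | or_and μ ν =>
    rw [LTL.sat_and]
    exact fun h => Or.inl h.1
  | ev_glEv μ =>
    rw [LTL.sat_gl]
    exact fun h => h k le_rfl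
  | glEv_evGl μ =>
    simp only [LTL.sat_gl, LTL.sat_ev]
    rintro ⟨l, -, hl⟩ n -
    exact ⟨max n l, le_max_left n l, hl _ (le_max_right n l)⟩
  | evGl_gl μ =>
    rw [LTL.sat_ev]
    exact fun h => ⟨k, le_rfl, h⟩
  | evI_glI μ i j hij =>
    rw [LTL.sat_glI, LTL.sat_evI]
    have hlt : ((k + i : ℕ) : ℕ∞) < (k : ℕ∞) + j := by
      rw [Nat.cast_add]
      exact (ENat.add_lt_add_iff_left (ENat.natCast_ne_top k)).2 hij
    exact fun h => ⟨k + i, le_rfl, hlt, h _ le_rfl hlt⟩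
  | untl_glAndGlEv μ ν =>
    simp only [LTL.sat_and, LTL.sat_gl, LTL.sat_ev, LTL.sat_untlInf]
    rintro ⟨hμ, hν⟩
    obtain ⟨l, hkl, hl⟩ := hν k le_rfl
    exact ⟨l, hkl, hl, fun m hm _ => hμ m hm⟩
  | evI_shrink μ i i' j j' hi hj hne =>
    simp only [LTL.sat_evI]
    rintro ⟨l, hil, hlj, hl⟩
    exact ⟨l, by omega, hlj.trans_le (by gcongr), hl⟩
  | not_anti μ ν _ ih => exact mt (ih k)
  | or_left μ μ' ν _ ih => exact Or.imp_left (ih k)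
  | or_right μ ν ν' _ ih => exact Or.imp_right (ih k)
  | next μ ν _ ih => exact ih (k + 1)
  | untl_right μ ν ν' i j hij _ ih =>
    rintro ⟨l, hil, hlj, hl, hμ⟩
    exact ⟨l, hil, hlj, ih l hl, hμ⟩
  | trans φ μ ψ _ _ ih₁ ih₂ => exact fun h => ih₁ k (ih₂ k h)
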